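/- Let K ≥ 1 and c₁, …, c_K ∈ ℝ. Define L(g) = Σ_{k=1}^{K} [ log₁₀( ln 10 · 10^{(c_k − g)/10} ) − 2·log₁₀( 1 + 10^{(c_k − g)/10} ) − 1 ] and let g* be the unique real number with Σ_{k=1}^{K} (1/10) · (10^{(c_k − g*)/10} − 1) / (10^{(c_k − g*)/10} + 1) = 0. Then L is strictly concave on ℝ and g* is its unique global maximizer: L(g) < L(g*) for every g ≠ g*. -/

import Mathlib

open Real Finset

/-- The likelihood summand has derivative `(1/10)·(10^((a-g)/10) - 1)/(10^((a-g)/10) + 1)`. -/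
theorem hasDerivAt_loglikelihood_summand (a g : ℝ) :
    HasDerivAt (fun g : ℝ => Real.logb 10 (Real.log 10 * (10 : ℝ) ^ ((a - g) / 10)) -
        2 * Real.logb 10 (1 + (10 : ℝ) ^ ((a - g) / 10)) - 1)
      (1 / 10 * (((10 : ℝ) ^ ((a - g) / 10) - 1) / ((10 : ℝ) ^ ((a - g) / 10) + 1))) g := by
  have hlog : Real.log 10 ≠ 0 := (Real.log_pos (by norm_num)).ne'
  have hpos : 0 < (10 : ℝ) ^ ((a - g) / 10) := Real.rpow_pos_of_pos (by norm_num) _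
  have hlin : HasDerivAt (fun g : ℝ => (a - g) / 10) (-1 / 10) g :=
    ((hasDerivAt_id g).const_sub a).div_const 10
  have hpow : HasDerivAt (fun g : ℝ => (10 : ℝ) ^ ((a - g) / 10))
      (Real.log 10 * (-1 / 10) * (10 : ℝ) ^ ((a - g) / 10)) g :=
    hlin.const_rpow (by norm_num)
  have h₁ := ((hpow.const_mul (Real.log 10)).log (by positivity)).div_const (Real.log 10)
  have h₂ := ((hpow.const_add 1).log (by positivity)).div_const (Real.log 10)
  refine ((h₁.sub (h₂.const_mul 2)).sub_const 1).congr_deriv ?_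
  field_simp
  ring

theorem strictAnti_loglikelihood_summand_deriv (a : ℝ) :
    StrictAnti fun g : ℝ =>
      1 / 10 * (((10 : ℝ) ^ ((a - g) / 10) - 1) / ((10 : ℝ) ^ ((a - g) / 10) + 1)) := by
  intro x y hxy
  have hlt : (10 : ℝ) ^ ((a - y) / 10) < (10 : ℝ) ^ ((a - x) / 10) :=
    Real.rpow_lt_rpow_of_exponent_lt (by norm_num) (by linarith)
  have hy : 0 < (10 : ℝ) ^ ((a - y) / 10) := Real.rpow_pos_of_pos (by norm_num) _
  refine mul_lt_mul_of_pos_left ?_ (by norm_num)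
  rw [div_lt_div_iff₀ (by linarith) (by linarith)]
  linarith

/-- A critical point of a function with strictly decreasing derivative is its unique
global maximizer. -/
theorem lt_of_hasDerivAt_of_strictAnti {f f' : ℝ → ℝ} (hf : ∀ x, HasDerivAt f (f' x) x)
    (hanti : StrictAnti f') {x₀ : ℝ} (h₀ : f' x₀ = 0) {x : ℝ} (hx : x ≠ x₀) : f x < f x₀ := by
  have hcont : Continuous f := continuous_iff_continuousAt.2 fun x => (hf x).continuousAt
  rcases hx.lt_or_gt with h | h
  · refine strictMonoOn_of_deriv_pos (convex_Iic x₀) hcont.continuousOn (fun y hy => ?_)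
      h.le (Set.mem_Iic.2 le_rfl) h
    rw [interior_Iic] at hy
    rw [(hf y).deriv, ← h₀]
    exact hanti hy
  · refine strictAntiOn_of_deriv_neg (convex_Ici x₀) hcont.continuousOn (fun y hy => ?_)
      (Set.mem_Ici.2 le_rfl) h.le h
    rw [interior_Ici] at hy
    rw [(hf y).deriv, ← h₀]
    exact hanti hy

/-- For `K ≥ 1` and constants `c₁, …, c_K`, the log-likelihood
`L(g) = Σₖ [log₁₀(ln 10 · 10^((cₖ-g)/10)) - 2·log₁₀(1 + 10^((cₖ-g)/10)) - 1]`
is strictly concave on `ℝ`, and the unique zero `g*` of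
`f₁(g) = Σₖ (1/10)·(10^((cₖ-g)/10) - 1)/(10^((cₖ-g)/10) + 1)` is its unique global
maximizer: `L(g) < L(g*)` for every `g ≠ g*`. -/
theorem loglikelihood_strictConcave_max (K : ℕ) (hK : 1 ≤ K) (c : Fin K → ℝ)
    (gstar : ℝ)
    (hstar : (∑ k : Fin K,
      1 / 10 * (((10 : ℝ) ^ ((c k - gstar) / 10) - 1) /
        ((10 : ℝ) ^ ((c k - gstar) / 10) + 1))) = 0) :
    StrictConcaveOn ℝ Set.univ
      (fun g : ℝ => ∑ k : Fin K,
        (Real.logb 10 (Real.log 10 * (10 : ℝ) ^ ((c k - g) / 10)) -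
          2 * Real.logb 10 (1 + (10 : ℝ) ^ ((c k - g) / 10)) - 1)) ∧
    ∀ g : ℝ, g ≠ gstar →
      (∑ k : Fin K,
        (Real.logb 10 (Real.log 10 * (10 : ℝ) ^ ((c k - g) / 10)) -
          2 * Real.logb 10 (1 + (10 : ℝ) ^ ((c k - g) / 10)) - 1)) <
      (∑ k : Fin K,
        (Real.logb 10 (Real.log 10 * (10 : ℝ) ^ ((c k - gstar) / 10)) -
          2 * Real.logb 10 (1 + (10 : ℝ) ^ ((c k - gstar) / 10)) - 1)) := by
  have hderiv := fun g : ℝ => HasDerivAt.fun_sum (u := Finset.univ) fun k _ =>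
    hasDerivAt_loglikelihood_summand (c k) g
  have hanti : StrictAnti fun g : ℝ => ∑ k : Fin K,
      1 / 10 * (((10 : ℝ) ^ ((c k - g) / 10) - 1) / ((10 : ℝ) ^ ((c k - g) / 10) + 1)) :=
    fun x y hxy => Finset.sum_lt_sum_of_nonempty ⟨⟨0, hK⟩, Finset.mem_univ _⟩
      fun k _ => strictAnti_loglikelihood_summand_deriv (c k) hxy
  refine ⟨StrictAnti.strictConcaveOn_univ_of_deriv
    (continuous_iff_continuousAt.2 fun g => (hderiv g).continuousAt) ?_,
    fun g hg => lt_of_hasDerivAt_of_strictAnti hderiv hanti hstar hg⟩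
  rwa [funext fun g => (hderiv g).deriv]
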